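/- Let T_i : ℝⁿ → ℝⁿ be α-firmly nonexpansive with constants α_i ≤ α < 1 for all i ∈ I, and assume the Markov operator 𝒫 possesses an invariant probability measure. Then any two ergodic invariant probability measures π and π̃ are shifted versions of each other: there exist s ∈ Supp π and s̃ ∈ Supp π̃ such that π(A) = π̃(A − (s − s̃)) for every Borel set A ⊆ ℝⁿ. -/

import Mathlib

open MeasureTheory Filter Topology

/-- The support of a measure. -/
def msupport {G : Type*} [TopologicalSpace G] [MeasurableSpace G]
    (μ : MeasureTheory.Measure G) : Set G :=
  {x | ∀ U ∈ nhds x, 0 < μ U}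

/-- One application of the dual Markov operator of the RFI, with `μξ` the law of `ξ`. -/
noncomputable def markovStep {G I : Type*} [MeasurableSpace G] [MeasurableSpace I]
    (μξ : MeasureTheory.Measure I) (T : I → G → G) (μ : MeasureTheory.Measure G) :
    MeasureTheory.Measure G :=
  μ.bind fun x => μξ.map fun i => T i x

/-- `π` is an ergodic invariant probability measure for the RFI Markov operator. -/
def IsErgodicInv {G I : Type*} [MeasurableSpace G] [MeasurableSpace I]
    (μξ : MeasureTheory.Measure I) (T : I → G → G) (π : MeasureTheory.Measure G) : Prop :=
  MeasureTheory.IsProbabilityMeasure π ∧ markovStep μξ T π = π ∧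
    ∀ A : Set G, MeasurableSet A →
      (∀ x ∈ A, (μξ.map fun i => T i x) A = 1) → π A = 0 ∨ π A = 1

open scoped BoundedContinuousFunction ENNReal ProbabilityTheory

lemma ae_mem_absorbing_core {X I : Type*} [MeasurableSpace X] [MeasurableSpace I]
    {ν : Measure I} [IsProbabilityMeasure ν] {Φ : X × I → X} (hΦ : Measurable Φ)
    {π : Measure X} [IsProbabilityMeasure π] (hinv : (π.prod ν).map Φ = π)
    {S : Set X} (hS : MeasurableSet S)
    (h : ∀ᵐ x ∂π, x ∈ S → ∀ᵐ i ∂ν, Φ (x, i) ∈ S) :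
    ∃ B ⊆ S, MeasurableSet B ∧ (∀ᵐ x ∂π, x ∈ S → x ∈ B) ∧
      ∀ x ∈ B, ∀ᵐ i ∂ν, Φ (x, i) ∈ B := by
  let A : ℕ → Set X := fun k =>
    Nat.rec S (fun _ B => B ∩ {x | ∀ᵐ i ∂ν, Φ (x, i) ∈ B}) k
  have A_succ (k : ℕ) : A (k + 1) = A k ∩ {x | ∀ᵐ i ∂ν, Φ (x, i) ∈ A k} := rfl
  have meas_next {B : Set X} (hB : MeasurableSet B) :
      MeasurableSet {x | ∀ᵐ i ∂ν, Φ (x, i) ∈ B} :=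
    measurable_measure_prodMk_left (ν := ν) (hΦ hB).compl (measurableSet_singleton 0)
  have key (k : ℕ) : MeasurableSet (A k) ∧ ∀ᵐ x ∂π, x ∈ S → x ∈ A k := by
    induction k with
    | zero => exact ⟨hS, .of_forall fun _ hx => hx⟩
    | succ k ih =>
      refine ⟨ih.1.inter (meas_next ih.1), ?_⟩
      have h₁ : ∀ᵐ x ∂π, ∀ᵐ i ∂ν, Φ (x, i) ∈ S → Φ (x, i) ∈ A k := by
        refine Measure.ae_ae_of_ae_prod (p := fun p => Φ p ∈ S → Φ p ∈ A k)
          (ae_of_ae_map (p := fun y => y ∈ S → y ∈ A k) hΦ.aemeasurable ?_)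
        rw [hinv]
        exact ih.2
      filter_upwards [h, h₁, ih.2] with x hx hx₁ hx₂ hxS
      refine ⟨hx₂ hxS, ?_⟩
      filter_upwards [hx hxS, hx₁] with i hi hi₁ using hi₁ hi
  refine ⟨⋂ k, A k, Set.iInter_subset A 0, .iInter fun k => (key k).1, ?_, fun x hx => ?_⟩
  · filter_upwards [ae_all_iff.2 fun k => (key k).2] with x hx hxS
    exact Set.mem_iInter.2 fun k => hx k hxS
  · have hx' := Set.mem_iInter.1 hx
    filter_upwards [ae_all_iff.2 fun k => (A_succ k ▸ hx' (k + 1)).2] with i hi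
    exact Set.mem_iInter.2 hi

lemma invariant_eq_smul_of_le_ergodic {X I : Type*} [MeasurableSpace X] [MeasurableSpace I]
    {ν : Measure I} [IsProbabilityMeasure ν] {Φ : X × I → X} (hΦ : Measurable Φ)
    {π : Measure X} [IsProbabilityMeasure π] (hinv : (π.prod ν).map Φ = π)
    (herg : ∀ A : Set X, MeasurableSet A → (∀ x ∈ A, ∀ᵐ i ∂ν, Φ (x, i) ∈ A) →
      π A = 0 ∨ π A = 1)
    {μ : Measure X} (hle : μ ≤ π) (hμ : (μ.prod ν).map Φ = μ) :
    μ = μ Set.univ • π := by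
  have : IsFiniteMeasure μ := isFiniteMeasure_of_le π hle
  have hac : μ ≪ π := Measure.absolutelyContinuous_of_le hle
  set f : X → ℝ := fun x => min 1 (μ.rnDeriv π x).toReal
  have hfae : ∀ᵐ x ∂π, f x = (μ.rnDeriv π x).toReal := by
    filter_upwards [Measure.rnDeriv_le_one_of_le hle] with x hx
    exact min_eq_right (by simpa using ENNReal.toReal_mono ENNReal.one_ne_top hx)
  have hfm : Measurable f :=
    measurable_const.min (Measure.measurable_rnDeriv μ π).ennreal_toReal
  have hf0 (x : X) : 0 ≤ f x := le_min zero_le_one ENNReal.toReal_nonneg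
  have hf1 (x : X) : f x ≤ 1 := min_le_left _ _
  have hden (h : X → ℝ) : ∫ x, f x * h x ∂π = ∫ x, h x ∂μ := by
    rw [← integral_rnDeriv_smul hac]
    refine integral_congr_ae ?_
    filter_upwards [hfae] with x hx
    rw [hx, smul_eq_mul]
  have hbdd {g : X × I → ℝ} (ρ : Measure (X × I)) [IsFiniteMeasure ρ] (hg : Measurable g)
      (h0 : ∀ p, 0 ≤ g p) (h1 : ∀ p, g p ≤ 1) : Integrable g ρ :=
    .of_bound hg.aestronglyMeasurable 1
      (.of_forall fun p => by rw [Real.norm_of_nonneg (h0 p)]; exact h1 p)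
  have hf₁ : Measurable fun p : X × I => f p.1 := hfm.comp measurable_fst
  have hf₂ : Measurable fun p : X × I => f (Φ p) := hfm.comp hΦ
  have i₁ : Integrable (fun p : X × I => f p.1 * f p.1) (π.prod ν) :=
    hbdd _ (hf₁.mul hf₁) (fun p => mul_nonneg (hf0 _) (hf0 _))
      fun p => mul_le_one₀ (hf1 _) (hf0 _) (hf1 _)
  have i₂ : Integrable (fun p : X × I => f (Φ p) * f (Φ p)) (π.prod ν) :=
    hbdd _ (hf₂.mul hf₂) (fun p => mul_nonneg (hf0 _) (hf0 _))
      fun p => mul_le_one₀ (hf1 _) (hf0 _) (hf1 _)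
  have i₃ : Integrable (fun p : X × I => f p.1 * f (Φ p)) (π.prod ν) :=
    hbdd _ (hf₁.mul hf₂) (fun p => mul_nonneg (hf0 _) (hf0 _))
      fun p => mul_le_one₀ (hf1 _) (hf0 _) (hf1 _)
  have e₁ : ∫ p, f p.1 * f p.1 ∂(π.prod ν) = ∫ x, f x * f x ∂π := by
    rw [integral_prod _ i₁]
    simp
  have e₂ : ∫ p, f (Φ p) * f (Φ p) ∂(π.prod ν) = ∫ x, f x * f x ∂π := by
    conv_rhs => rw [← hinv]
    exact (integral_map hΦ.aemeasurable (hfm.mul hfm).aestronglyMeasurable).symm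
  have e₃ : ∫ p, f p.1 * f (Φ p) ∂(π.prod ν) = ∫ x, f x * f x ∂π := by
    rw [integral_prod _ i₃]
    simp only [integral_const_mul]
    rw [hden, hden, ← integral_prod _ (hbdd _ hf₂ (fun p => hf0 _) fun p => hf1 _)]
    conv_rhs => rw [← hμ]
    rw [integral_map hΦ.aemeasurable hfm.aestronglyMeasurable]
  have hexp : (fun p : X × I => (f p.1 - f (Φ p)) ^ 2) =
      ((fun p => f p.1 * f p.1) + fun p => f (Φ p) * f (Φ p)) -
        fun p => 2 * (f p.1 * f (Φ p)) := by
    ext p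
    simp only [Pi.sub_apply, Pi.add_apply]
    ring
  have hzero : ∫ p, (f p.1 - f (Φ p)) ^ 2 ∂(π.prod ν) = 0 := by
    rw [hexp, integral_sub' (i₁.add i₂) (i₃.const_mul 2), integral_add' i₁ i₂,
      integral_const_mul, e₁, e₂, e₃]
    ring
  have hae : ∀ᵐ p ∂(π.prod ν), f (Φ p) = f p.1 := by
    rw [integral_eq_zero_iff_of_nonneg (fun p => sq_nonneg _)
      (hexp ▸ (i₁.add i₂).sub (i₃.const_mul 2))] at hzero
    filter_upwards [hzero] with p hp
    exact (sub_eq_zero.1 (pow_eq_zero_iff two_ne_zero |>.1 hp)).symm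
  obtain ⟨a, ha⟩ : ∃ a, f =ᵐ[π] Function.const X a := by
    refine exists_eventuallyEq_const_of_forall_separating MeasurableSet fun U hU => ?_
    obtain ⟨B, hBS, hB, hSB, hBabs⟩ := ae_mem_absorbing_core hΦ hinv (hfm hU) (by
      filter_upwards [Measure.ae_ae_of_ae_prod hae] with x hx hxU
      filter_upwards [hx] with i hi
      rw [Set.mem_preimage, hi]
      exact hxU)
    rcases herg B hB hBabs with h | h
    · right
      filter_upwards [hSB, measure_eq_zero_iff_ae_notMem.1 h] with x hx hx' hxU
      exact hx' (hx hxU)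
    · left
      filter_upwards [(mem_ae_iff_prob_eq_one hB).2 h] with x hx using hBS hx
  have hsmul : μ = ENNReal.ofReal a • π := by
    rw [← withDensity_const, ← Measure.withDensity_rnDeriv_eq μ π hac]
    refine withDensity_congr_ae ?_
    filter_upwards [hfae, ha, Measure.rnDeriv_ne_top μ π] with x h₁ h₂ h₃
    rw [← ENNReal.ofReal_toReal h₃, ← h₁, h₂]
    rfl
  conv_rhs => rw [hsmul]
  simpa using hsmul

lemma map_prodMk_eq_prod_of_ergodic {Z X F I : Type*} [MeasurableSpace Z] [MeasurableSpace X]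
    [MeasurableSpace F] [MeasurableSpace I]
    {ν : Measure I} [IsProbabilityMeasure ν] {Φ : X × I → X} (hΦ : Measurable Φ)
    {π : Measure X} [IsProbabilityMeasure π] (hinv : (π.prod ν).map Φ = π)
    (herg : ∀ A : Set X, MeasurableSet A → (∀ x ∈ A, ∀ᵐ i ∂ν, Φ (x, i) ∈ A) →
      π A = 0 ∨ π A = 1)
    {Ψ : Z × I → Z} (hΨ : Measurable Ψ) {m : Measure Z} [IsProbabilityMeasure m]
    (hm : (m.prod ν).map Ψ = m) {q : Z → X} (hq : Measurable q)
    (hqΨ : ∀ p, q (Ψ p) = Φ (q p.1, p.2)) (hmq : m.map q = π)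
    {D : Z → F} (hD : Measurable D) (hDΨ : ∀ᵐ p ∂(m.prod ν), D (Ψ p) = D p.1) :
    m.map (fun z => (D z, q z)) = (m.map D).prod π := by
  refine (Measure.prod_eq fun B A hB hA => ?_).symm
  set μ := (m.restrict (D ⁻¹' B)).map q with hμ
  have hle : μ ≤ π := by
    rw [← hmq]
    exact Measure.map_mono Measure.restrict_le_self hq
  have hμinv : (μ.prod ν).map Φ = μ := by
    ext A hA
    have hqi : Measurable fun p : Z × I => (q p.1, p.2) := by fun_prop
    have h₁ : μ.prod ν = ((m.restrict (D ⁻¹' B)).prod ν).map fun p => (q p.1, p.2) := by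
      have := Measure.map_prod_map (m.restrict (D ⁻¹' B)) ν hq measurable_id
      rwa [Measure.map_id] at this
    rw [h₁, Measure.map_map hΦ hqi, Measure.map_apply (hΦ.comp hqi) hA, hμ,
      Measure.map_apply hq hA, Measure.restrict_apply (hq hA)]
    have h₂ : (m.restrict (D ⁻¹' B)).prod ν = (m.prod ν).restrict ((D ⁻¹' B) ×ˢ Set.univ) := by
      rw [← Measure.prod_restrict, Measure.restrict_univ]
    rw [h₂, Measure.restrict_apply (hΦ.comp hqi hA)]
    conv_rhs => rw [← hm]
    rw [Measure.map_apply hΨ ((hq hA).inter (hD hB))]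
    refine measure_congr ?_
    filter_upwards [hDΨ] with p hp
    refine propext ?_
    change (Φ (q p.1, p.2) ∈ A ∧ (D p.1 ∈ B ∧ True)) ↔ (q (Ψ p) ∈ A ∧ D (Ψ p) ∈ B)
    rw [hp, hqΨ, and_true]
  have := congrArg (fun ρ : Measure X => ρ A)
    (invariant_eq_smul_of_le_ergodic hΦ hinv herg hle hμinv)
  simp only [Measure.smul_apply, smul_eq_mul] at this
  rw [hμ, Measure.map_apply hq hA, Measure.map_apply hq .univ, Set.preimage_univ,
    Measure.restrict_apply (hq hA), Measure.restrict_apply .univ, Set.univ_inter] at this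
  rw [Measure.map_apply (hD.prodMk hq) (hB.prod hA), Measure.map_apply hD hB, ← this,
    Set.inter_comm]
  rfl

lemma exists_invariant_of_isCompact_cesaro {X I : Type*} [TopologicalSpace X]
    [FirstCountableTopology X] [HasOuterApproxClosed X] [MeasurableSpace X] [BorelSpace X]
    [MeasurableSpace I]
    {ν : Measure I} [IsProbabilityMeasure ν] {Φ : X × I → X} (hΦ : Measurable Φ)
    (hcont : ∀ i, Continuous fun x => Φ (x, i))
    {S : Set (ProbabilityMeasure X)} (hS : IsCompact S) {γ : ℕ → Measure X}
    [∀ k, IsProbabilityMeasure (γ k)] (hγ : ∀ k, γ (k + 1) = ((γ k).prod ν).map Φ)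
    {m : ℕ → ProbabilityMeasure X} (hmS : ∀ N, m N ∈ S)
    (hm : ∀ N, (m N : Measure X) = ((N + 1 : ℕ) : ℝ≥0∞)⁻¹ • ∑ k ∈ Finset.range (N + 1), γ k) :
    ∃ μ ∈ S, ((μ : Measure X).prod ν).map Φ = μ := by
  obtain ⟨μ, hμS, hμ⟩ := hS.ultrafilter_le_nhds ((hyperfilter ℕ).map m)
    (le_principal_iff.2 (Ultrafilter.mem_map.2 (univ_mem' hmS)))
  have hlim : Tendsto m (hyperfilter ℕ : Filter ℕ) (𝓝 μ) := hμ
  refine ⟨μ, hμS, ?_⟩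
  have : IsProbabilityMeasure (((μ : Measure X).prod ν).map Φ) :=
    Measure.isProbabilityMeasure_map hΦ.aemeasurable
  refine ext_of_forall_integral_eq_of_IsFiniteMeasure fun f => ?_
  have hfΦ : Measurable fun p => f (Φ p) := f.continuous.measurable.comp hΦ
  let Q : X →ᵇ ℝ := BoundedContinuousFunction.ofNormedAddCommGroup
    (fun x => ∫ i, f (Φ (x, i)) ∂ν)
    (continuous_of_dominated (bound := fun _ => ‖f‖)
      (fun x => (hfΦ.comp measurable_prodMk_left).aestronglyMeasurable)
      (fun x => .of_forall fun i => f.norm_coe_le_norm _) (integrable_const _)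
      (.of_forall fun i => f.continuous.comp (hcont i)))
    ‖f‖ (fun x => by
      simpa using norm_integral_le_of_norm_le_const (μ := ν) (f := fun i => f (Φ (x, i)))
        (.of_forall fun i => f.norm_coe_le_norm _))
  have hQ (ρ : Measure X) [IsProbabilityMeasure ρ] :
      ∫ x, f x ∂((ρ.prod ν).map Φ) = ∫ x, Q x ∂ρ := by
    rw [integral_map hΦ.aemeasurable f.continuous.measurable.aestronglyMeasurable,
      integral_prod]
    · rfl
    · exact .of_bound hfΦ.aestronglyMeasurable ‖f‖ (.of_forall fun p => f.norm_coe_le_norm _)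
  have hint (N : ℕ) (g : X →ᵇ ℝ) : ∫ x, g x ∂(m N : Measure X)
      = ((N : ℝ) + 1)⁻¹ * ∑ k ∈ Finset.range (N + 1), ∫ x, g x ∂(γ k) := by
    rw [hm, integral_smul_measure, integral_finsetSum_measure fun k _ => g.integrable _,
      ENNReal.toReal_inv, ENNReal.toReal_natCast, smul_eq_mul, Nat.cast_add, Nat.cast_one]
  have hdiff (N : ℕ) : ∫ x, Q x ∂(m N : Measure X) - ∫ x, f x ∂(m N : Measure X)
      = ((N : ℝ) + 1)⁻¹ * (∫ x, f x ∂(γ (N + 1)) - ∫ x, f x ∂(γ 0)) := by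
    rw [hint, hint, ← mul_sub, ← Finset.sum_sub_distrib,
      ← Finset.sum_range_sub fun k => ∫ x, f x ∂(γ k)]
    simp_rw [hγ, hQ]
  have hzero : Tendsto (fun N => ∫ x, Q x ∂(m N : Measure X) - ∫ x, f x ∂(m N : Measure X))
      atTop (𝓝 0) := by
    have hb : Tendsto (fun N : ℕ => ((N : ℝ) + 1)⁻¹ * (2 * ‖f‖)) atTop (𝓝 0) := by
      simpa [one_div] using (tendsto_one_div_add_atTop_nhds_zero_nat (𝕜 := ℝ)).mul_const (2 * ‖f‖)
    refine squeeze_zero_norm (fun N => ?_) hb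
    rw [hdiff, norm_mul, Real.norm_of_nonneg (by positivity)]
    gcongr
    have hle (k : ℕ) : ‖∫ x, f x ∂(γ k)‖ ≤ ‖f‖ := by
      simpa using norm_integral_le_of_norm_le_const (μ := γ k) (f := f)
        (.of_forall fun x => f.norm_coe_le_norm x)
    linarith [norm_sub_le (∫ x, f x ∂(γ (N + 1))) (∫ x, f x ∂(γ 0)), hle (N + 1), hle 0]
  have hweak := ProbabilityMeasure.tendsto_iff_forall_integral_tendsto.1 hlim
  have := tendsto_nhds_unique ((hweak Q).sub (hweak f))
    (hzero.mono_left (Nat.hyperfilter_le_atTop))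
  rw [hQ]
  linarith

lemma isCompact_setOf_coupling {X Y : Type*} [TopologicalSpace X] [TopologicalSpace Y]
    [PolishSpace X] [PolishSpace Y] [MeasurableSpace X] [BorelSpace X]
    [MeasurableSpace Y] [BorelSpace Y] (π : Measure X) (π' : Measure Y)
    [IsProbabilityMeasure π] [IsProbabilityMeasure π'] :
    IsCompact {m : ProbabilityMeasure (X × Y) |
      (m : Measure (X × Y)).map Prod.fst = π ∧ (m : Measure (X × Y)).map Prod.snd = π'} := by
  let _ := TopologicalSpace.upgradeIsCompletelyMetrizable X
  let _ := TopologicalSpace.upgradeIsCompletelyMetrizable Y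
  set S := {m : ProbabilityMeasure (X × Y) |
      (m : Measure (X × Y)).map Prod.fst = π ∧ (m : Measure (X × Y)).map Prod.snd = π'}
  have hclosed : IsClosed S := by
    have h₁ : IsClosed {m : ProbabilityMeasure (X × Y) |
        m.map continuous_fst.measurable.aemeasurable = (⟨π, inferInstance⟩ : ProbabilityMeasure X)} :=
      isClosed_eq (ProbabilityMeasure.continuous_map continuous_fst) continuous_const
    have h₂ : IsClosed {m : ProbabilityMeasure (X × Y) |
        m.map continuous_snd.measurable.aemeasurable = (⟨π', inferInstance⟩ : ProbabilityMeasure Y)} :=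
      isClosed_eq (ProbabilityMeasure.continuous_map continuous_snd) continuous_const
    convert h₁.inter h₂ using 1
    ext m
    exact ⟨fun h => ⟨Subtype.ext h.1, Subtype.ext h.2⟩,
      fun h => ⟨congrArg Subtype.val h.1, congrArg Subtype.val h.2⟩⟩
  rw [← hclosed.closure_eq]
  refine isCompact_closure_of_isTightMeasureSet ?_
  rw [isTightMeasureSet_iff_exists_isCompact_measure_compl_le]
  intro ε hε
  obtain ⟨K, hK, hKε⟩ := isTightMeasureSet_iff_exists_isCompact_measure_compl_le.1
    (isTightMeasureSet_singleton (μ := π)) (ε / 2) (ENNReal.half_pos hε.ne')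
  obtain ⟨L, hL, hLε⟩ := isTightMeasureSet_iff_exists_isCompact_measure_compl_le.1
    (isTightMeasureSet_singleton (μ := π')) (ε / 2) (ENNReal.half_pos hε.ne')
  refine ⟨K ×ˢ L, hK.prod hL, ?_⟩
  rintro _ ⟨m, ⟨hm₁, hm₂⟩, rfl⟩
  calc (m : Measure (X × Y)) (K ×ˢ L)ᶜ
      ≤ (m : Measure (X × Y)) (Prod.fst ⁻¹' Kᶜ) + (m : Measure (X × Y)) (Prod.snd ⁻¹' Lᶜ) := by
        refine (measure_mono fun z hz => ?_).trans (measure_union_le _ _)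
        simpa [Set.mem_prod, imp_iff_not_or] using hz
    _ = π Kᶜ + π' Lᶜ := by
        rw [← hm₁, ← hm₂, Measure.map_apply measurable_fst hK.measurableSet.compl,
          Measure.map_apply measurable_snd hL.measurableSet.compl]
    _ ≤ ε := (add_le_add (hKε π rfl) (hLε π' rfl)).trans (ENNReal.add_halves ε).le

lemma invariant_coupling_sub_eq {E I : Type*} [NormedAddCommGroup E] [SecondCountableTopology E]
    [MeasurableSpace E] [BorelSpace E] [MeasurableSpace I]
    {ν : Measure I} [IsProbabilityMeasure ν] {T : I → E → E}
    (hΦ : Measurable fun p : E × I => T p.2 p.1)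
    (hne : ∀ i x y, ‖T i x - T i y‖ ≤ ‖x - y‖)
    (hrigid : ∀ i x y, ‖T i x - T i y‖ = ‖x - y‖ → T i x - T i y = x - y)
    {m : Measure (E × E)} [IsProbabilityMeasure m]
    (hm : (m.prod ν).map (fun p => (T p.2 p.1.1, T p.2 p.1.2)) = m) :
    ∀ᵐ p ∂(m.prod ν), T p.2 p.1.1 - T p.2 p.1.2 = p.1.1 - p.1.2 := by
  have h₁ : Measurable fun p : (E × E) × I => T p.2 p.1.1 :=
    hΦ.comp (measurable_fst.fst.prodMk measurable_snd)
  have h₂ : Measurable fun p : (E × E) × I => T p.2 p.1.2 :=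
    hΦ.comp (measurable_fst.snd.prodMk measurable_snd)
  have hφ : Measurable fun z : E × E => Real.exp (-‖z.1 - z.2‖) := by fun_prop
  have hb {X : Type _} [MeasurableSpace X] (ρ : Measure X) [IsFiniteMeasure ρ] {g : X → ℝ}
      (hg : Measurable g) (h0 : ∀ x, 0 ≤ g x) :
      Integrable (fun x => Real.exp (-g x)) ρ :=
    .of_bound (by fun_prop) 1 (.of_forall fun x => by
      simpa [Real.norm_of_nonneg (Real.exp_pos _).le] using h0 x)
  have i₁ : Integrable (fun p : (E × E) × I => Real.exp (-‖T p.2 p.1.1 - T p.2 p.1.2‖))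
      (m.prod ν) := hb _ (h₁.sub h₂).norm fun _ => norm_nonneg _
  have i₂ : Integrable (fun p : (E × E) × I => Real.exp (-‖p.1.1 - p.1.2‖))
      (m.prod ν) := hb _ (by fun_prop) fun _ => norm_nonneg _
  have heq : ∫ p, Real.exp (-‖p.1.1 - p.1.2‖) ∂(m.prod ν)
      = ∫ p, Real.exp (-‖T p.2 p.1.1 - T p.2 p.1.2‖) ∂(m.prod ν) := by
    rw [integral_prod _ i₂]
    simp only [integral_const, probReal_univ, one_smul]
    conv_lhs => rw [← hm]
    exact integral_map (h₁.prodMk h₂).aemeasurable hφ.aestronglyMeasurable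
  have hle : ∀ p : (E × E) × I,
      Real.exp (-‖p.1.1 - p.1.2‖) ≤ Real.exp (-‖T p.2 p.1.1 - T p.2 p.1.2‖) := fun p =>
    Real.exp_le_exp.2 (neg_le_neg (hne _ _ _))
  filter_upwards [(integral_eq_iff_of_ae_le i₂ i₁ (.of_forall hle)).1 heq] with p hp
  exact hrigid _ _ _ (neg_injective (Real.exp_injective hp)).symm

lemma ae_eq_map_add_of_prod_eq {E : Type*} [AddCommGroup E] [MeasurableSpace E]
    [MeasurableAdd₂ E] [MeasurableSpace.CountablyGenerated E]
    {ρ π π' : Measure E} [IsProbabilityMeasure ρ] [IsProbabilityMeasure π]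
    [IsProbabilityMeasure π']
    (h : ρ.prod π = (ρ.prod π').map fun p => (p.1, p.2 + p.1)) :
    ∀ᵐ d ∂ρ, π = π'.map fun y => y + d := by
  have hadd : Measurable fun p : E × E => p.2 + p.1 := measurable_snd.add measurable_fst
  let κ : ProbabilityTheory.Kernel E E :=
    (ProbabilityTheory.Kernel.id ×ₖ ProbabilityTheory.Kernel.const E π').map
      fun p : E × E => p.2 + p.1
  have hκ (d : E) : κ d = π'.map fun y => y + d := by
    rw [ProbabilityTheory.Kernel.map_apply _ hadd, ProbabilityTheory.Kernel.prod_apply,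
      ProbabilityTheory.Kernel.id_apply, ProbabilityTheory.Kernel.const_apply,
      Measure.dirac_prod, Measure.map_map hadd measurable_prodMk_left]
    rfl
  have : ProbabilityTheory.IsMarkovKernel κ := ProbabilityTheory.Kernel.IsMarkovKernel.map _ hadd
  have hprod : ρ ⊗ₘ ProbabilityTheory.Kernel.const E π = ρ ⊗ₘ κ := by
    rw [Measure.compProd_const, h]
    ext A hA
    have hs : Measurable fun p : E × E => (p.1, p.2 + p.1) := measurable_fst.prodMk hadd
    rw [Measure.map_apply hs hA, Measure.prod_apply (hs hA), Measure.compProd_apply hA]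
    refine lintegral_congr fun d => ?_
    rw [hκ]
    exact (Measure.map_apply (measurable_id.add_const d) (measurable_prodMk_left hA)).symm
  filter_upwards [ProbabilityTheory.Kernel.ae_eq_of_compProd_eq hprod] with d hd
  rw [← hκ, ← hd, ProbabilityTheory.Kernel.const_apply]

lemma markovStep_eq_map_prod {G I : Type*} [MeasurableSpace G] [MeasurableSpace I]
    {ν : Measure I} [IsProbabilityMeasure ν] {T : I → G → G}
    (hΦ : Measurable fun p : G × I => T p.2 p.1) (μ : Measure G) [SFinite μ] :
    markovStep ν T μ = (μ.prod ν).map fun p => T p.2 p.1 := by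
  have hmap (x : G) {A : Set G} (hA : MeasurableSet A) : (ν.map fun i => T i x) A =
      ν (Prod.mk x ⁻¹' ((fun p : G × I => T p.2 p.1) ⁻¹' A)) :=
    Measure.map_apply (hΦ.comp measurable_prodMk_left) hA
  have hmeas : Measurable fun x => ν.map fun i => T i x := by
    refine Measure.measurable_of_measurable_coe _ fun A hA => ?_
    simp_rw [hmap _ hA]
    exact measurable_measure_prodMk_left (hΦ hA)
  ext A hA
  rw [markovStep, Measure.bind_apply hA hmeas.aemeasurable, Measure.map_apply hΦ hA,
    Measure.prod_apply (hΦ hA)]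
  exact lintegral_congr fun x => hmap x hA

lemma IsErgodicInv.measure_eq_zero_or_one {G I : Type*} [MeasurableSpace G] [MeasurableSpace I]
    {ν : Measure I} [IsProbabilityMeasure ν] {T : I → G → G}
    (hΦ : Measurable fun p : G × I => T p.2 p.1) {π : Measure G} (hπ : IsErgodicInv ν T π)
    {A : Set G} (hA : MeasurableSet A) (h : ∀ x ∈ A, ∀ᵐ i ∂ν, T i x ∈ A) :
    π A = 0 ∨ π A = 1 := by
  refine hπ.2.2 A hA fun x hx => ?_
  have hx' : Measurable fun i => T i x := hΦ.comp measurable_prodMk_left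
  rw [Measure.map_apply hx' hA, ← mem_ae_iff_prob_eq_one (hx' hA)]
  exact h x hx

lemma measurable_pair_step {G I : Type*} [MeasurableSpace G] [MeasurableSpace I]
    {T : I → G → G} (hΦ : Measurable fun p : G × I => T p.2 p.1) :
    Measurable fun p : (G × G) × I => (T p.2 p.1.1, T p.2 p.1.2) :=
  (hΦ.comp (measurable_fst.fst.prodMk measurable_snd)).prodMk
    (hΦ.comp (measurable_fst.snd.prodMk measurable_snd))

lemma map_pair_step {Z G I : Type*} [MeasurableSpace Z] [MeasurableSpace G] [MeasurableSpace I]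
    {ν : Measure I} [IsProbabilityMeasure ν] {Φ : G × I → G} (hΦ : Measurable Φ)
    {Ψ : Z × I → Z} (hΨ : Measurable Ψ) {q : Z → G} (hq : Measurable q)
    (hqΨ : ∀ p, q (Ψ p) = Φ (q p.1, p.2)) (m : Measure Z) [SFinite m] :
    ((m.prod ν).map Ψ).map q = ((m.map q).prod ν).map Φ := by
  have h := Measure.map_prod_map m ν hq measurable_id
  rw [Measure.map_id] at h
  rw [h, Measure.map_map hΦ (by fun_prop), Measure.map_map hq hΨ]
  congr 1
  ext p
  exact hqΨ p

lemma exists_invariant_coupling {E I : Type*} [TopologicalSpace E] [PolishSpace E]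
    [MeasurableSpace E] [BorelSpace E] [MeasurableSpace I]
    {ν : Measure I} [IsProbabilityMeasure ν] {T : I → E → E}
    (hΦ : Measurable fun p : E × I => T p.2 p.1) (hcont : ∀ i, Continuous (T i))
    {π π' : Measure E} [IsProbabilityMeasure π] [IsProbabilityMeasure π']
    (hπ : (π.prod ν).map (fun p => T p.2 p.1) = π)
    (hπ' : (π'.prod ν).map (fun p => T p.2 p.1) = π') :
    ∃ m : ProbabilityMeasure (E × E), (m : Measure (E × E)).map Prod.fst = π ∧
      (m : Measure (E × E)).map Prod.snd = π' ∧
      ((m : Measure (E × E)).prod ν).map (fun p => (T p.2 p.1.1, T p.2 p.1.2)) = m := by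
  let _ := TopologicalSpace.upgradeIsCompletelyMetrizable E
  have hΨ := measurable_pair_step hΦ
  obtain ⟨γ, hγ₀, hγ⟩ : ∃ γ : ℕ → Measure (E × E), γ 0 = π.prod π' ∧
      ∀ k, γ (k + 1) = ((γ k).prod ν).map fun p => (T p.2 p.1.1, T p.2 p.1.2) :=
    ⟨fun k => Nat.rec (π.prod π')
      (fun _ ρ => (ρ.prod ν).map fun p => (T p.2 p.1.1, T p.2 p.1.2)) k, rfl, fun _ => rfl⟩
  have hprob (k : ℕ) : IsProbabilityMeasure (γ k) := by
    induction k with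
    | zero => rw [hγ₀]; infer_instance
    | succ k ih => rw [hγ]; exact Measure.isProbabilityMeasure_map hΨ.aemeasurable
  have hfst (k : ℕ) : (γ k).map Prod.fst = π := by
    induction k with
    | zero => simp [hγ₀]
    | succ k ih => rw [hγ, map_pair_step hΦ hΨ measurable_fst (fun _ => rfl), ih, hπ]
  have hsnd (k : ℕ) : (γ k).map Prod.snd = π' := by
    induction k with
    | zero => simp [hγ₀]
    | succ k ih => rw [hγ, map_pair_step hΦ hΨ measurable_snd (fun _ => rfl), ih, hπ']
  have havg {X : Type _} [MeasurableSpace X] (N : ℕ) (ρ : ℕ → Measure (E × E))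
      {q : E × E → X} (hq : Measurable q) {τ : Measure X} (hρ : ∀ k, (ρ k).map q = τ) :
      (((N + 1 : ℕ) : ℝ≥0∞)⁻¹ • ∑ k ∈ Finset.range (N + 1), ρ k).map q = τ := by
    rw [Measure.map_smul, ← Measure.mapₗ_apply_of_measurable hq, map_sum]
    simp only [Measure.mapₗ_apply_of_measurable hq, hρ, Finset.sum_const, Finset.card_range]
    rw [← Nat.cast_smul_eq_nsmul ℝ≥0∞, smul_smul,
      ENNReal.inv_mul_cancel (by simp) (ENNReal.natCast_ne_top _), one_smul]
  have hmprob (N : ℕ) : IsProbabilityMeasure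
      (((N + 1 : ℕ) : ℝ≥0∞)⁻¹ • ∑ k ∈ Finset.range (N + 1), γ k) := by
    have h := havg N γ measurable_fst hfst
    refine ⟨?_⟩
    rw [← Set.preimage_univ (f := Prod.fst), ← Measure.map_apply measurable_fst .univ, h,
      measure_univ]
  obtain ⟨m, ⟨h₁, h₂⟩, hm⟩ := exists_invariant_of_isCompact_cesaro hΨ
    (fun i => ((hcont i).comp continuous_fst).prodMk ((hcont i).comp continuous_snd))
    (isCompact_setOf_coupling π π') hγ
    (m := fun N => ⟨_, hmprob N⟩)
    (fun N => ⟨havg N γ measurable_fst hfst, havg N γ measurable_snd hsnd⟩) fun _ => rfl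
  exact ⟨m, h₁, h₂, hm⟩

/-- structure of ergodic measures for α-firmly nonexpansive mappings:
each `T i : ℝⁿ → ℝⁿ` α-firmly nonexpansive with constants `αᵢ ≤ α < 1`, and the Markov
operator possesses an invariant probability measure.  Then any two ergodic invariant
probability measures `π, π̃` are shifts of each other: there are `s ∈ Supp π` and
`s̃ ∈ Supp π̃` with `π(A) = π̃(A − (s − s̃))` for every Borel `A`. -/
theorem stmt18
    {n : ℕ} {I : Type*} [MeasurableSpace I]
    (T : I → EuclideanSpace ℝ (Fin n) → EuclideanSpace ℝ (Fin n))
    (α : ℝ) (hα : α < 1)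
    (hfne : ∀ i : I, ∃ αi : ℝ, 0 < αi ∧ αi ≤ α ∧
      ∀ x y : EuclideanSpace ℝ (Fin n),
        ‖T i x - T i y‖ ^ 2 ≤ ‖x - y‖ ^ 2 -
          ((1 - αi) / αi) * ‖(x - T i x) - (y - T i y)‖ ^ 2)
    (hΦ : Measurable fun p : EuclideanSpace ℝ (Fin n) × I => T p.2 p.1)
    (μξ : Measure I) [IsProbabilityMeasure μξ]
    (hinv : ∃ π₀ : Measure (EuclideanSpace ℝ (Fin n)),
      IsProbabilityMeasure π₀ ∧ markovStep μξ T π₀ = π₀)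
    (π π' : Measure (EuclideanSpace ℝ (Fin n)))
    (hπ : IsErgodicInv μξ T π) (hπ' : IsErgodicInv μξ T π') :
    ∃ s ∈ msupport π, ∃ s' ∈ msupport π',
      ∀ A : Set (EuclideanSpace ℝ (Fin n)), MeasurableSet A →
        π A = π' ((fun y => y + (s - s')) ⁻¹' A) := by
  have := hπ.1
  have := hπ'.1
  have hne (i : I) (x y : EuclideanSpace ℝ (Fin n)) : ‖T i x - T i y‖ ≤ ‖x - y‖ := by
    obtain ⟨a, ha0, haα, ha⟩ := hfne i
    have hc : 0 ≤ (1 - a) / a := div_nonneg (by linarith) ha0.le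
    refine le_of_sq_le_sq ?_ (norm_nonneg _)
    nlinarith [ha x y, mul_nonneg hc (sq_nonneg ‖(x - T i x) - (y - T i y)‖)]
  have hrigid (i : I) (x y : EuclideanSpace ℝ (Fin n)) (h : ‖T i x - T i y‖ = ‖x - y‖) :
      T i x - T i y = x - y := by
    obtain ⟨a, ha0, haα, ha⟩ := hfne i
    have hc : 0 < (1 - a) / a := div_pos (by linarith) ha0
    have hsq : ‖(x - T i x) - (y - T i y)‖ ^ 2 ≤ 0 := by
      have := ha x y
      rw [h] at this
      exact nonpos_of_mul_nonpos_right (by linarith) hc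
    have hz : (x - T i x) - (y - T i y) = 0 :=
      norm_eq_zero.1 (pow_eq_zero_iff two_ne_zero |>.1 (le_antisymm hsq (sq_nonneg _)))
    rw [sub_sub_sub_comm] at hz
    exact (sub_eq_zero.1 hz).symm
  have hcont (i : I) : Continuous (T i) :=
    (LipschitzWith.of_dist_le_mul (K := 1) fun x y => by
      simpa [dist_eq_norm] using hne i x y).continuous
  have hinvπ := (markovStep_eq_map_prod hΦ π).symm.trans hπ.2.1
  have hinvπ' := (markovStep_eq_map_prod hΦ π').symm.trans hπ'.2.1
  have herg (A : Set (EuclideanSpace ℝ (Fin n))) (hA : MeasurableSet A) :=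
    hπ.measure_eq_zero_or_one hΦ hA
  have herg' (A : Set (EuclideanSpace ℝ (Fin n))) (hA : MeasurableSet A) :=
    hπ'.measure_eq_zero_or_one hΦ hA
  obtain ⟨m, hm₁, hm₂, hm⟩ := exists_invariant_coupling hΦ hcont hinvπ hinvπ'
  have hsub := invariant_coupling_sub_eq hΦ hne hrigid hm
  have hΨ := measurable_pair_step hΦ
  have hD : Measurable fun z : EuclideanSpace ℝ (Fin n) × EuclideanSpace ℝ (Fin n) =>
    z.1 - z.2 := by fun_prop
  have hprod := map_prodMk_eq_prod_of_ergodic hΦ hinvπ herg hΨ hm measurable_fst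
    (fun _ => rfl) hm₁ hD hsub
  have hprod' := map_prodMk_eq_prod_of_ergodic hΦ hinvπ' herg' hΨ hm measurable_snd
    (fun _ => rfl) hm₂ hD hsub
  have hρ := Measure.isProbabilityMeasure_map (μ := (m : Measure _)) hD.aemeasurable
  obtain ⟨d, hd⟩ := (ae_eq_map_add_of_prod_eq (π := π) (π' := π') (by
    rw [← hprod, ← hprod', Measure.map_map (by fun_prop) (by fun_prop)]
    simp [Function.comp_def])).exists
  obtain ⟨s', hs'⟩ := Measure.nonempty_support (IsProbabilityMeasure.ne_zero π')
  rw [Measure.mem_support_iff_forall] at hs'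
  have hadd : Continuous fun y : EuclideanSpace ℝ (Fin n) => y + d := by fun_prop
  refine ⟨s' + d, fun U hU => ?_, s', hs', fun A hA => ?_⟩
  · rw [hd]
    exact (hs' _ (hadd.continuousAt.preimage_mem_nhds hU)).trans_le
      (Measure.le_map_apply hadd.aemeasurable U)
  · rw [add_sub_cancel_left, hd, Measure.map_apply hadd.measurable hA]
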